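/- arXiv:2004.09129 — 3 statements merged into one kernel-verified Lean document; each statement's English description precedes it below -/
import Mathlib

section
/- Let e, e' be distinct edges of the spanning tree T such that Cut(e, e') < min{Cov(e), Cov(e')} (the 2-respecting cut determined by (e, e') is strictly smaller than both 1-respecting cuts). Then Cov(e, e') > ½ · max{Cov(e), Cov(e')}; in particular e and e' are interested in each other. -/
open SimpleGraph

variable {V : Type}

/-- An edge `x` covers a tree edge `e` if `e` lies on the (unique) `T`-path
between the endpoints of `x`. -/
def Covers (T : SimpleGraph V) (x e : Sym2 V) : Prop :=
  ∀ u u' : V, x = s(u, u') → ∀ p : T.Path u u', e ∈ p.1.edges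

/-- The edge `x` crosses the bipartition `(S, Sᶜ)`. -/
def Crosses (S : Set V) (x : Sym2 V) : Prop :=
  ∃ a b : V, x = s(a, b) ∧ a ∈ S ∧ b ∉ S

/-- Total weight of a set of edges. -/
noncomputable def setW (w : Sym2 V → ℕ) (S : Set (Sym2 V)) : ℕ :=
  ∑ᶠ x ∈ S, w x

/-- The set of edges of `G` covering the tree edge `e`. -/
def covSet (G T : SimpleGraph V) (e : Sym2 V) : Set (Sym2 V) :=
  {x ∈ G.edgeSet | Covers T x e}

/-- Membership of `u` and `v` in `S` differs iff `s(u, v)` crosses `S`. -/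
theorem crosses_mk_iff (S : Set V) (u v : V) : Crosses S s(u, v) ↔ ¬(u ∈ S ↔ v ∈ S) := by
  constructor
  · rintro ⟨a, b, hab, ha, hb⟩
    rcases Sym2.eq_iff.1 hab with ⟨rfl, rfl⟩ | ⟨rfl, rfl⟩ <;> tauto
  · intro h
    by_cases hu : u ∈ S
    · exact ⟨u, v, rfl, hu, fun hv => h (iff_of_true hu hv)⟩
    · exact ⟨v, u, Sym2.eq_swap, by tauto, hu⟩

open Classical in
/-- A walk has its endpoints on the same side of `S` iff it crosses `S` an even number of times. -/
theorem even_countP_crosses_iff {T : SimpleGraph V} (S : Set V) {u v : V} (p : T.Walk u v) :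
    Even (p.edges.countP (fun f => Crosses S f)) ↔ (u ∈ S ↔ v ∈ S) := by
  induction p with
  | nil => simp
  | @cons a b c h p ih =>
    rw [Walk.edges_cons, List.countP_cons]
    by_cases hc : Crosses S s(a, b)
    · have hab := (crosses_mk_iff S a b).1 hc
      simp only [hc, decide_true, if_true, Nat.even_add_one, ih]
      tauto
    · have hab := not_not.1 (mt (crosses_mk_iff S a b).2 hc)
      simp [hc, ih, hab]

/-- If `e` is the only edge of a trail that crosses `S`, then the endpoints of the trail are
separated by `S`. -/
theorem crosses_of_existsUnique_crossing {T : SimpleGraph V} {S : Set V} {u v : V}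
    {p : T.Walk u v} (hp : p.IsTrail) {e : Sym2 V} (he : e ∈ p.edges)
    (h : ∀ f ∈ p.edges, Crosses S f ↔ f = e) : Crosses S s(u, v) := by
  classical
  rw [crosses_mk_iff, ← even_countP_crosses_iff S p,
    List.countP_congr (q := fun f => f == e) (by simpa using h)]
  have : p.edges.count e = 1 := List.count_eq_one_of_mem hp.edges_nodup he
  rw [List.count] at this
  simp [this]

/-- If `e` and `e'` are the only edges of `T` crossing `S`, an edge that covers `e` but not `e'`
crosses `S`. -/
theorem crosses_of_covers_of_not_covers {T : SimpleGraph V} {S : Set V} {e e' x : Sym2 V}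
    (hS : {f : Sym2 V | f ∈ T.edgeSet ∧ Crosses S f} = {e, e'})
    (h : Covers T x e) (h' : ¬Covers T x e') : Crosses S x := by
  unfold Covers at h'
  push Not at h'
  obtain ⟨u, v, rfl, p, hp⟩ := h'
  refine crosses_of_existsUnique_crossing p.2.isTrail (h u v rfl p) fun f hf => ?_
  have hiff : (f ∈ T.edgeSet ∧ Crosses S f) ↔ f = e ∨ f = e' := Set.ext_iff.1 hS f
  have hfT : f ∈ T.edgeSet := p.1.edges_subset_edgeSet hf
  have hfe : f ≠ e' := fun hh => hp (hh ▸ hf)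
  tauto

theorem setW_inter_add_diff [Finite V] (w : Sym2 V → ℕ) (A B : Set (Sym2 V)) :
    setW w (A ∩ B) + setW w (A \ B) = setW w A :=
  finsum_mem_inter_add_sdiff B A.toFinite

theorem setW_diff_add_diff_le [Finite V] (w : Sym2 V → ℕ) {A B C : Set (Sym2 V)}
    (hA : A \ B ⊆ C) (hB : B \ A ⊆ C) : setW w (A \ B) + setW w (B \ A) ≤ setW w C := by
  have hdisj : setW w (A \ B ∪ B \ A) = setW w (A \ B) + setW w (B \ A) :=
    finsum_mem_union disjoint_sdiff_sdiff (Set.toFinite _) (Set.toFinite _)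
  have hsplit := setW_inter_add_diff w C (A \ B ∪ B \ A)
  rw [Set.inter_eq_right.2 (Set.union_subset hA hB)] at hsplit
  omega

/-- if the 2-respecting cut determined by distinct tree edges `(e, e')`
is strictly smaller than both 1-respecting cuts `Cov(e)` and `Cov(e')`, then
`Cov(e,e') > ½·max{Cov(e), Cov(e')}`; in particular `e` and `e'` are interested in
each other (`Cov(e,e') > Cov(e)/2` and `Cov(e,e') > Cov(e')/2`). -/
theorem mutually_interested_of_small_two_respecting_cut [Fintype V]
    (G T : SimpleGraph V) (hG : G.Connected) (hle : T ≤ G) (hT : T.IsTree) (r : V)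
    (w : Sym2 V → ℕ) (hw : ∀ x ∈ G.edgeSet, 1 ≤ w x)
    (e e' : Sym2 V) (he : e ∈ T.edgeSet) (he' : e' ∈ T.edgeSet) (hne : e ≠ e')
    (S : Set V) (hS : {f : Sym2 V | f ∈ T.edgeSet ∧ Crosses S f} = {e, e'})
    (hlt : setW w {x ∈ G.edgeSet | Crosses S x}
      < min (setW w (covSet G T e)) (setW w (covSet G T e'))) :
    max (setW w (covSet G T e)) (setW w (covSet G T e'))
        < 2 * setW w (covSet G T e ∩ covSet G T e') ∧
    setW w (covSet G T e) < 2 * setW w (covSet G T e ∩ covSet G T e') ∧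
    setW w (covSet G T e') < 2 * setW w (covSet G T e ∩ covSet G T e') := by
  have hdiff : ∀ {f f' : Sym2 V}, {g : Sym2 V | g ∈ T.edgeSet ∧ Crosses S g} = {f, f'} →
      covSet G T f \ covSet G T f' ⊆ {x ∈ G.edgeSet | Crosses S x} := fun hf x hx =>
    ⟨hx.1.1, crosses_of_covers_of_not_covers hf hx.1.2 fun h => hx.2 ⟨hx.1.1, h⟩⟩
  have hcut := setW_diff_add_diff_le w (hdiff hS) (hdiff (hS.trans (Set.pair_comm e e')))
  have hsplit := setW_inter_add_diff w (covSet G T e) (covSet G T e')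
  have hsplit' := setW_inter_add_diff w (covSet G T e') (covSet G T e)
  rw [Set.inter_comm] at hsplit'
  omega
end

section
/- Let F', F be edge-disjoint subtrees of T, each having exactly two vertices with T-neighbors outside it — r_{F'}, d_{F'} for F' and r_F, d_F for F, where d_{F'} is a descendant of r_{F'} and d_F is a descendant of r_F — and let P' (resp. P) be the highway of F' (resp. F), i.e., the tree path from r_{F'} to d_{F'} (resp. from r_F to d_F). Let e' be an edge of P' not in F and e an edge of P not in F'. Then every edge x of G covering both e' and e satisfies exactly one of: (1) both endpoints of x lie outside V(F') ∪ V(F), and then x covers all of P' and all of P; (2) x has an endpoint in V(F') and no endpoint in V(F), and then x covers all of P; (3) x has an endpoint in V(F) and no endpoint in V(F'), and then x covers all of P'; (4) x has one endpoint in V(F') and one endpoint in V(F). Consequently Cov(e', e) = Cov^extr(P', P) + Cov^extr(e', P) + Cov^extr(e, P') + Cov_F(e', e), where the four terms are the total weights of the edges in classes (1)–(4) respectively. -/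
open SimpleGraph

variable {V : Type}

/-- `a` is a (weak) ancestor of `v` in the tree `T` rooted at `r`:
`a` lies on every `T`-path from `v` to `r`. -/
def IsAnc (T : SimpleGraph V) (r a v : V) : Prop :=
  ∀ p : T.Path v r, a ∈ p.1.support

/-- `x` covers every edge in the list `l`. -/
def CoversAll (T : SimpleGraph V) (x : Sym2 V) (l : List (Sym2 V)) : Prop :=
  ∀ f ∈ l, Covers T x f

/-- `v` is a vertex of the subgraph `F` having a `T`-neighbor outside `F`. -/
def hasOutNbr (T : SimpleGraph V) (F : T.Subgraph) (v : V) : Prop :=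
  v ∈ F.verts ∧ ∃ u, T.Adj v u ∧ ¬ F.Adj v u ∧ u ∉ F.verts

/-- class (1): both endpoints of `x` lie outside `V(F') ∪ V(F)`. -/
def classOne (T : SimpleGraph V) (F' F : T.Subgraph) (x : Sym2 V) : Prop :=
  ∀ v ∈ x, v ∉ F'.verts ∧ v ∉ F.verts

/-- class (2): `x` has an endpoint in `V(F')` and no endpoint in `V(F)`
(class (3) is `classTwo T F F'`). -/
def classTwo (T : SimpleGraph V) (F' F : T.Subgraph) (x : Sym2 V) : Prop :=
  (∃ v ∈ x, v ∈ F'.verts) ∧ ∀ v ∈ x, v ∉ F.verts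

/-- class (4): `x` has one endpoint in `V(F')` and one endpoint in `V(F)`. -/
def classFour (T : SimpleGraph V) (F' F : T.Subgraph) (x : Sym2 V) : Prop :=
  ∃ u v : V, x = s(u, v) ∧ u ∈ F'.verts ∧ v ∈ F.verts

namespace SimpleGraph

namespace Walk

theorem exists_eq_append_cons_of_mem_edges {T : SimpleGraph V} {u v : V} (p : T.Walk u v)
    {e : Sym2 V} (he : e ∈ p.edges) :
    ∃ (y z : V) (h : T.Adj y z) (p₁ : T.Walk u y) (p₂ : T.Walk z v),
      e = s(y, z) ∧ p = p₁.append (cons h p₂) := by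
  induction p with
  | nil => simp at he
  | cons h p ih =>
    rw [edges_cons, List.mem_cons] at he
    rcases he with rfl | he
    · exact ⟨_, _, h, nil, p, rfl, rfl⟩
    · obtain ⟨y, z, h', p₁, p₂, rfl, rfl⟩ := ih he
      exact ⟨y, z, h', cons h p₁, p₂, rfl, rfl⟩

end Walk

variable {T : SimpleGraph V} {F : T.Subgraph}

/-- In an acyclic graph, a path between two vertices of a connected subgraph stays inside it. -/
theorem IsAcyclic.edges_subset_of_subgraph_connected (hT : T.IsAcyclic) (hF : F.Connected)
    {u v : V} (hu : u ∈ F.verts) (hv : v ∈ F.verts) {p : T.Walk u v} (hp : p.IsPath)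
    {e : Sym2 V} (he : e ∈ p.edges) : e ∈ F.edgeSet := by
  obtain ⟨q, hq⟩ := (hF.coe.preconnected ⟨u, hu⟩ ⟨v, hv⟩).exists_isPath
  have hq' : (q.map F.hom).IsPath := hq.map F.hom_injective
  have hpq : p = q.map F.hom :=
    congrArg Subtype.val ((hT.subsingleton_path u v).elim ⟨p, hp⟩ ⟨_, hq'⟩)
  have hedges : p.edges = q.edges.map (Sym2.map F.hom) := hpq ▸ q.edges_map F.hom
  rw [hedges, List.mem_map] at he
  obtain ⟨f, hf, rfl⟩ := he
  have hf' := q.edges_subset_edgeSet hf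
  induction f with
  | _ a b => exact hf'

/-- A path starting in a connected subgraph of an acyclic graph and using one of its edges
has its first edge in that subgraph. -/
theorem IsAcyclic.adj_of_cons_isPath (hT : T.IsAcyclic) (hF : F.Connected)
    {u w v : V} (hu : u ∈ F.verts) {h : T.Adj u w} {p : T.Walk w v}
    (hp : (Walk.cons h p).IsPath) {e : Sym2 V} (he : e ∈ (Walk.cons h p).edges)
    (heF : e ∈ F.edgeSet) : s(u, w) ∈ F.edgeSet := by
  classical
  rw [Walk.edges_cons, List.mem_cons] at he
  rcases he with rfl | he
  · exact heF
  · induction e with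
    | _ y z =>
      have hy := p.fst_mem_support_of_mem_edges he
      rw [Walk.cons_isPath_iff] at hp
      have hpath : (Walk.cons h (p.takeUntil y hy)).IsPath :=
        (Walk.cons_isPath_iff _ _).mpr
          ⟨hp.1.takeUntil hy, fun hm => hp.2 (p.support_takeUntil_subset_support hy hm)⟩
      exact hT.edges_subset_of_subgraph_connected hF hu (F.edge_vert heF) hpath (by simp)

end SimpleGraph

theorem exists_mem_support_hasOutNbr {T : SimpleGraph V} {F : T.Subgraph} {u v : V}
    (p : T.Walk u v) (hu : u ∉ F.verts) (hv : v ∈ F.verts) :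
    ∃ c ∈ p.support, hasOutNbr T F c := by
  obtain ⟨d, hd, h₁, h₂⟩ := p.exists_boundary_dart F.vertsᶜ hu (by simpa using hv)
  refine ⟨d.snd, p.dart_snd_mem_support_of_mem_darts hd, by simpa using h₂, d.fst, d.adj.symm,
    fun h => h₁ (F.edge_vert h.symm), h₁⟩

/-- A path with both ends outside `F` that uses an edge of `F` traverses the whole path between
the two boundary vertices of `F`. -/
theorem edges_subset_of_boundary_pair {T : SimpleGraph V} (hT : T.IsAcyclic) {F : T.Subgraph}
    {a b : V} (hbd : {v | hasOutNbr T F v} = {a, b}) (q : T.Path a b) {u v : V}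
    (p : T.Path u v) (hu : u ∉ F.verts) (hv : v ∉ F.verts) {e : Sym2 V}
    (he : e ∈ p.1.edges) (heF : e ∈ F.edgeSet) : q.1.edges ⊆ p.1.edges := by
  classical
  obtain ⟨p, hp⟩ := p
  obtain ⟨y, z, h, p₁, p₂, rfl, rfl⟩ := p.exists_eq_append_cons_of_mem_edges he
  obtain ⟨c, hc, hcF⟩ := exists_mem_support_hasOutNbr p₁ hu (F.edge_vert heF)
  obtain ⟨d, hd, hdF⟩ := exists_mem_support_hasOutNbr p₂.reverse hv (F.edge_vert heF.symm)
  rw [Walk.support_reverse, List.mem_reverse] at hd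
  let m : T.Walk c d := (p₁.dropUntil c hc).append (Walk.cons h (p₂.takeUntil d hd))
  have hsplit : p₁.append (Walk.cons h p₂) =
      (p₁.takeUntil c hc).append (m.append (p₂.dropUntil d hd)) := by
    simp only [m]
    rw [← Walk.append_assoc, Walk.cons_append, Walk.take_spec, Walk.append_assoc, Walk.take_spec]
  have hm : m.IsPath := by
    have hp' : (p₁.append (Walk.cons h p₂)).IsPath := hp
    rw [hsplit] at hp'
    exact hp'.of_append_right.of_append_left
  have hsub : m.edges ⊆ (p₁.append (Walk.cons h p₂)).edges := by
    rw [hsplit]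
    intro f hf
    simp [hf]
  have hcd : c ≠ d := by
    rintro rfl
    have hl := Walk.length_eq_zero_iff.mpr (Walk.isPath_iff_nil.mp hm)
    simp [m] at hl
  have hc' : c ∈ ({a, b} : Set V) := hbd ▸ hcF
  have hd' : d ∈ ({a, b} : Set V) := hbd ▸ hdF
  rcases hc' with rfl | rfl <;> rcases hd' with rfl | rfl
  · exact absurd rfl hcd
  · rw [(hT.subsingleton_path _ _).elim q ⟨m, hm⟩]
    exact hsub
  · rw [(hT.subsingleton_path _ _).elim q (Path.reverse ⟨m, hm⟩)]
    intro f hf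
    exact hsub (by simpa [Path.reverse] using hf)
  · exact absurd rfl hcd

theorem coversAll_of_forall_notMem {T : SimpleGraph V} (hT : T.IsAcyclic) {F : T.Subgraph}
    {a b : V} (hbd : {v | hasOutNbr T F v} = {a, b}) (q : T.Path a b) {x e : Sym2 V}
    (hx : ∀ v ∈ x, v ∉ F.verts) (he : Covers T x e) (heF : e ∈ F.edgeSet) :
    CoversAll T x q.1.edges := by
  rintro f hf u v rfl p
  exact edges_subset_of_boundary_pair hT hbd q p (hx u (Sym2.mem_mk_left u v))
    (hx v (Sym2.mem_mk_right u v)) (he u v rfl p) heF hf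

/-- A vertex shared by two edge-disjoint subtrees cannot be an endpoint of an edge covering
an edge of each of them. -/
theorem notMem_inter_of_covers {T : SimpleGraph V} (hT : T.IsTree) {F' F : T.Subgraph}
    (hF' : F'.Connected) (hF : F.Connected) (hdisj : Disjoint F'.edgeSet F.edgeSet)
    {u v : V} {e' e : Sym2 V} (he' : Covers T s(u, v) e') (he : Covers T s(u, v) e)
    (heF' : e' ∈ F'.edgeSet) (heF : e ∈ F.edgeSet) (hu' : u ∈ F'.verts) : u ∉ F.verts := by
  intro hu
  obtain ⟨p, hp⟩ := (hT.connected.preconnected u v).exists_isPath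
  have h₁ := he' u v rfl ⟨p, hp⟩
  have h₂ := he u v rfl ⟨p, hp⟩
  cases p with
  | nil => simp at h₁
  | cons h p =>
    exact Set.disjoint_left.mp hdisj
      (hT.isAcyclic.adj_of_cons_isPath hF' hu' hp h₁ heF')
      (hT.isAcyclic.adj_of_cons_isPath hF hu hp h₂ heF)

theorem classFour_of_exists {T : SimpleGraph V} (hT : T.IsTree) {F' F : T.Subgraph}
    (hF' : F'.Connected) (hF : F.Connected) (hdisj : Disjoint F'.edgeSet F.edgeSet)
    {x e' e : Sym2 V} (he' : Covers T x e') (he : Covers T x e)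
    (heF' : e' ∈ F'.edgeSet) (heF : e ∈ F.edgeSet)
    (h' : ∃ v ∈ x, v ∈ F'.verts) (h : ∃ v ∈ x, v ∈ F.verts) : classFour T F' F x := by
  obtain ⟨u, hux, hu⟩ := h'
  obtain ⟨v, rfl⟩ := hux
  have hnot := notMem_inter_of_covers hT hF' hF hdisj he' he heF' heF hu
  obtain ⟨t, htx, ht⟩ := h
  rcases Sym2.mem_iff.mp htx with rfl | rfl
  · exact absurd ht hnot
  · exact ⟨u, t, rfl, hu, ht⟩

theorem not_classOne_and_classTwo {T : SimpleGraph V} {F' F : T.Subgraph} {x : Sym2 V} :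
    ¬ (classOne T F' F x ∧ classTwo T F' F x) := by
  rintro ⟨h, ⟨v, hv, hvF⟩, -⟩
  exact (h v hv).1 hvF

theorem classOne_symm {T : SimpleGraph V} {F' F : T.Subgraph} {x : Sym2 V}
    (h : classOne T F' F x) : classOne T F F' x :=
  fun v hv => (h v hv).symm

theorem classFour_symm {T : SimpleGraph V} {F' F : T.Subgraph} {x : Sym2 V}
    (h : classFour T F' F x) : classFour T F F' x := by
  obtain ⟨u, v, rfl, hu, hv⟩ := h
  exact ⟨v, u, Sym2.eq_swap, hv, hu⟩

theorem not_classOne_and_classFour {T : SimpleGraph V} {F' F : T.Subgraph} {x : Sym2 V} :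
    ¬ (classOne T F' F x ∧ classFour T F' F x) := by
  rintro ⟨h, u, v, rfl, hu, -⟩
  exact (h u (Sym2.mem_mk_left u v)).1 hu

theorem not_classTwo_and_classTwo {T : SimpleGraph V} {F' F : T.Subgraph} {x : Sym2 V} :
    ¬ (classTwo T F' F x ∧ classTwo T F F' x) := by
  rintro ⟨⟨⟨v, hv, hvF⟩, -⟩, -, h⟩
  exact h v hv hvF

theorem not_classTwo_and_classFour {T : SimpleGraph V} {F' F : T.Subgraph} {x : Sym2 V} :
    ¬ (classTwo T F' F x ∧ classFour T F' F x) := by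
  rintro ⟨⟨-, h⟩, u, v, rfl, -, hv⟩
  exact h v (Sym2.mem_mk_right u v) hv

theorem setW_union [Finite V] (w : Sym2 V → ℕ) {S S' : Set (Sym2 V)} (h : Disjoint S S') :
    setW w (S ∪ S') = setW w S + setW w S' :=
  finsum_mem_union h S.toFinite S'.toFinite

/-- for two edge-disjoint fragments `F'`, `F` with highways `q'`, `q`,
an edge `e'` of `q'` not in `F` and an edge `e` of `q` not in `F'`, every edge of `G`
covering both `e'` and `e` falls into exactly one of the four classes (with the
stated covering consequences), and `Cov(e',e)` is the sum of the four class
weights. -/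
theorem cov_split_two_fragments [Fintype V]
    (G T : SimpleGraph V) (hG : G.Connected) (hle : T ≤ G) (hT : T.IsTree) (r : V)
    (w : Sym2 V → ℕ) (hw : ∀ x ∈ G.edgeSet, 1 ≤ w x)
    (F' F : T.Subgraph) (hF'c : F'.Connected) (hFc : F.Connected)
    (hdisj : Disjoint F'.edgeSet F.edgeSet)
    (rF' dF' rF dF : V) (hne' : rF' ≠ dF') (hne : rF ≠ dF)
    (hbd' : {v | hasOutNbr T F' v} = {rF', dF'})
    (hbd : {v | hasOutNbr T F v} = {rF, dF})
    (hdesc' : IsAnc T r rF' dF') (hdesc : IsAnc T r rF dF)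
    (q' : T.Path rF' dF') (q : T.Path rF dF)
    (e' : Sym2 V) (he' : e' ∈ q'.1.edges) (he'F : e' ∉ F.edgeSet)
    (e : Sym2 V) (he : e ∈ q.1.edges) (heF' : e ∉ F'.edgeSet) :
    (∀ x ∈ G.edgeSet, Covers T x e' → Covers T x e →
      ((classOne T F' F x ∧ CoversAll T x q'.1.edges ∧ CoversAll T x q.1.edges) ∨
        (classTwo T F' F x ∧ CoversAll T x q.1.edges) ∨
        (classTwo T F F' x ∧ CoversAll T x q'.1.edges) ∨
        classFour T F' F x) ∧
      ¬ (classOne T F' F x ∧ classTwo T F' F x) ∧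
      ¬ (classOne T F' F x ∧ classTwo T F F' x) ∧
      ¬ (classOne T F' F x ∧ classFour T F' F x) ∧
      ¬ (classTwo T F' F x ∧ classTwo T F F' x) ∧
      ¬ (classTwo T F' F x ∧ classFour T F' F x) ∧
      ¬ (classTwo T F F' x ∧ classFour T F' F x)) ∧
    setW w {x ∈ G.edgeSet | Covers T x e' ∧ Covers T x e}
      = setW w {x ∈ G.edgeSet | Covers T x e' ∧ Covers T x e ∧ classOne T F' F x}
        + setW w {x ∈ G.edgeSet | Covers T x e' ∧ Covers T x e ∧ classTwo T F' F x}
        + setW w {x ∈ G.edgeSet | Covers T x e' ∧ Covers T x e ∧ classTwo T F F' x}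
        + setW w {x ∈ G.edgeSet | Covers T x e' ∧ Covers T x e ∧ classFour T F' F x} := by
  have heF : e ∈ F.edgeSet := by
    have hr : hasOutNbr T F rF := hbd.symm.subset (Set.mem_insert _ _)
    have hd : hasOutNbr T F dF := hbd.symm.subset (Set.mem_insert_of_mem _ rfl)
    exact hT.isAcyclic.edges_subset_of_subgraph_connected hFc hr.1 hd.1 q.2 he
  have heF'' : e' ∈ F'.edgeSet := by
    have hr : hasOutNbr T F' rF' := hbd'.symm.subset (Set.mem_insert _ _)
    have hd : hasOutNbr T F' dF' := hbd'.symm.subset (Set.mem_insert_of_mem _ rfl)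
    exact hT.isAcyclic.edges_subset_of_subgraph_connected hF'c hr.1 hd.1 q'.2 he'
  have hclass : ∀ x ∈ G.edgeSet, Covers T x e' → Covers T x e →
      ((classOne T F' F x ∧ CoversAll T x q'.1.edges ∧ CoversAll T x q.1.edges) ∨
        (classTwo T F' F x ∧ CoversAll T x q.1.edges) ∨
        (classTwo T F F' x ∧ CoversAll T x q'.1.edges) ∨
        classFour T F' F x) := by
    intro x _ hx' hx
    have hall := fun h => coversAll_of_forall_notMem hT.isAcyclic hbd q h hx heF
    have hall' := fun h => coversAll_of_forall_notMem hT.isAcyclic hbd' q' h hx' heF''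
    by_cases h' : ∃ v ∈ x, v ∈ F'.verts <;> by_cases h : ∃ v ∈ x, v ∈ F.verts
    · exact .inr (.inr (.inr (classFour_of_exists hT hF'c hFc hdisj hx' hx heF'' heF h' h)))
    · push Not at h
      exact .inr (.inl ⟨⟨h', h⟩, hall h⟩)
    · push Not at h'
      exact .inr (.inr (.inl ⟨⟨h, h'⟩, hall' h'⟩))
    · push Not at h h'
      exact .inl ⟨fun v hv => ⟨h' v hv, h v hv⟩, hall' h', hall h⟩
  have h₁₃ : ∀ x, ¬ (classOne T F' F x ∧ classTwo T F F' x) := fun x h =>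
    not_classOne_and_classTwo ⟨classOne_symm h.1, h.2⟩
  have h₃₄ : ∀ x, ¬ (classTwo T F F' x ∧ classFour T F' F x) := fun x h =>
    not_classTwo_and_classFour ⟨h.1, classFour_symm h.2⟩
  refine ⟨fun x hxG hx' hx => ⟨hclass x hxG hx' hx, not_classOne_and_classTwo, h₁₃ x,
    not_classOne_and_classFour, not_classTwo_and_classTwo, not_classTwo_and_classFour,
    h₃₄ x⟩, ?_⟩
  rw [← setW_union, ← setW_union, ← setW_union]
  · congr 1
    ext x
    constructor
    · rintro ⟨hxG, hx', hx⟩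
      rcases hclass x hxG hx' hx with h | h | h | h
      · exact .inl (.inl (.inl ⟨hxG, hx', hx, h.1⟩))
      · exact .inl (.inl (.inr ⟨hxG, hx', hx, h.1⟩))
      · exact .inl (.inr ⟨hxG, hx', hx, h.1⟩)
      · exact .inr ⟨hxG, hx', hx, h⟩
    · rintro (((h | h) | h) | h) <;> exact ⟨h.1, h.2.1, h.2.2.1⟩
  · rw [Set.disjoint_left]
    rintro x ((h | h) | h) h₄
    · exact not_classOne_and_classFour ⟨h.2.2.2, h₄.2.2.2⟩
    · exact not_classTwo_and_classFour ⟨h.2.2.2, h₄.2.2.2⟩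
    · exact h₃₄ x ⟨h.2.2.2, h₄.2.2.2⟩
  · rw [Set.disjoint_left]
    rintro x (h | h) h₃
    · exact h₁₃ x ⟨h.2.2.2, h₃.2.2.2⟩
    · exact not_classTwo_and_classTwo ⟨h.2.2.2, h₃.2.2.2⟩
  · rw [Set.disjoint_left]
    intro x h h₂
    exact not_classOne_and_classTwo ⟨h.2.2.2, h₂.2.2.2⟩
end

section
/- In a finite rooted tree T, any simple path contains at most two pairwise-orthogonal edges: if e, e', e'' are edges of T that are pairwise orthogonal (no two of them lie on a common root-to-leaf path), then no simple path in T contains all three of e, e', e''. -/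
open SimpleGraph

variable {V : Type}

/-- Two tree edges are orthogonal: they do not lie on a common descending path
from the root (equivalently, on a common root-to-leaf path). -/
def OrthE (T : SimpleGraph V) (r : V) (f g : Sym2 V) : Prop :=
  ¬ ∃ (u : V) (q : T.Path r u), f ∈ q.1.edges ∧ g ∈ q.1.edges

/-- In an acyclic graph, every walk uses all the edges of the path joining its endpoints. -/
theorem SimpleGraph.IsAcyclic.edges_path_subset {G : SimpleGraph V} (hG : G.IsAcyclic) {a b : V}
    (p : G.Path a b) (w : G.Walk a b) : p.1.edges ⊆ w.edges := by
  classical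
  rw [(hG.subsingleton_path a b).elim p w.toPath]
  exact w.edges_toPath_subset_edges

/-- in a finite rooted tree, no simple path contains three pairwise
orthogonal edges. -/
theorem no_path_through_three_orthogonal_edges [Fintype V]
    (T : SimpleGraph V) (hT : T.IsTree) (r : V)
    (e e' e'' : Sym2 V)
    (he : e ∈ T.edgeSet) (he' : e' ∈ T.edgeSet) (he'' : e'' ∈ T.edgeSet)
    (h1 : OrthE T r e e') (h2 : OrthE T r e e'') (h3 : OrthE T r e' e'') :
    ¬ ∃ (a b : V) (p : T.Path a b),
      e ∈ p.1.edges ∧ e' ∈ p.1.edges ∧ e'' ∈ p.1.edges := by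
  rintro ⟨a, b, p, hp, hp', hp''⟩
  classical
  obtain ⟨qa⟩ := hT.connected.preconnected r a
  obtain ⟨qb⟩ := hT.connected.preconnected r b
  have key : ∀ f ∈ p.1.edges, f ∈ qa.toPath.1.edges ∨ f ∈ qb.toPath.1.edges := fun f hf ↦ by
    simpa using hT.isAcyclic.edges_path_subset p (qa.toPath.1.reverse.append qb.toPath.1) hf
  have on_path {f g : Sym2 V} (h : OrthE T r f g) (u : V) (q : T.Path r u)
      (hf : f ∈ q.1.edges) (hg : g ∈ q.1.edges) : False := h ⟨u, q, hf, hg⟩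
  rcases key e hp with h | h <;> rcases key e' hp' with h' | h' <;>
    rcases key e'' hp'' with h'' | h'' <;>
    first
    | exact on_path h1 _ _ h h'
    | exact on_path h2 _ _ h h''
    | exact on_path h3 _ _ h' h''
end
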